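/- arXiv:1702.02590 — 2 statements merged into one kernel-verified Lean document; each statement's English description precedes it below -/
import Mathlib

section
/- Let R be an ω₁-short linear order, let Σ be a σ-algebra on R containing all initial segments (-∞, r] = {s : s ≤ r}, and let P be a probability measure on Σ. Then for every subset X of R, the set ⋃_{x∈X} (-∞, x] belongs to Σ and P(⋃_{x∈X} (-∞, x]) = sup_{x∈X} P(-∞, x], where the supremum over the empty set is taken to be 0. -/
open MeasureTheory

/-- The set of countable ordinals (the first uncountable ordinal ω₁), with its natural order. -/
abbrev Omega1 : Type 1 := {o : Ordinal // o.card ≤ Cardinal.aleph0}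

theorem Omega1.countable_Iio (o : Omega1) : (Set.Iio o).Countable := by
  have h : (Set.Iio o.1).Countable := by
    rw [← Cardinal.le_aleph0_iff_set_countable, Cardinal.mk_Iio_ordinal,
      Cardinal.lift_le_aleph0]
    exact o.2
  exact (h.preimage Subtype.val_injective).mono fun p hp => hp

theorem exists_orderEmbedding_omega1 {α : Type*} [LinearOrder α]
    (h : ∀ C : Set α, C.Countable → ∃ x, ∀ y ∈ C, y < x) : Nonempty (Omega1 ↪o α) := by
  obtain ⟨x₀, -⟩ := h ∅ Set.countable_empty
  have h' : ∀ C : Set α, ∃ x, C.Countable → ∀ y ∈ C, y < x := fun C => by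
    by_cases hC : C.Countable
    · exact (h C hC).imp fun _ hx _ => hx
    · exact ⟨x₀, fun h => absurd h hC⟩
  choose g hg using h'
  let f : Omega1 → α := wellFounded_lt.fix fun o ih => g (Set.range fun p : Set.Iio o => ih p p.2)
  have hf (o : Omega1) : f o = g (Set.range fun p : Set.Iio o => f p) :=
    wellFounded_lt.fix_eq _ o
  refine ⟨OrderEmbedding.ofStrictMono f fun p o hpo => ?_⟩
  have := (Omega1.countable_Iio o).to_subtype
  rw [hf o]
  exact hg _ (Set.countable_range _) _ ⟨⟨p, hpo⟩, rfl⟩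

theorem exists_countable_isCofinal {α : Type*} [LinearOrder α]
    (h : ¬ Nonempty (Omega1 ↪o α)) : ∃ C : Set α, C.Countable ∧ IsCofinal C := by
  by_contra! hC
  exact h (exists_orderEmbedding_omega1 fun C hc => not_isCofinal_iff.1 (hC C hc))

theorem stmt2 (R : Type*) [LinearOrder R] [MeasurableSpace R]
    (hshort : ¬ Nonempty (Omega1 ↪o R))
    (hIic : ∀ r : R, MeasurableSet (Set.Iic r))
    (P : Measure R) [IsProbabilityMeasure P] :
    ∀ X : Set R,
      MeasurableSet (⋃ x ∈ X, Set.Iic x) ∧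
      P (⋃ x ∈ X, Set.Iic x) = ⨆ x ∈ X, P (Set.Iic x) := by
  intro X
  obtain ⟨C, hC, hcof⟩ := exists_countable_isCofinal (α := X) fun ⟨e⟩ =>
    hshort ⟨e.trans (OrderEmbedding.subtype (· ∈ X))⟩
  have hU : ⋃ x ∈ X, Set.Iic x = ⋃ x ∈ C, Set.Iic (x : R) := by
    apply subset_antisymm
    · refine Set.iUnion₂_subset fun x hx => ?_
      obtain ⟨c, hc, hxc⟩ := hcof ⟨x, hx⟩
      exact (Set.Iic_subset_Iic.2 (Subtype.coe_le_coe.2 hxc)).trans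
        (Set.subset_biUnion_of_mem (u := fun x : X => Set.Iic (x : R)) hc)
    · exact Set.iUnion₂_subset fun c _ =>
        Set.subset_biUnion_of_mem (u := fun x : R => Set.Iic x) c.2
  refine ⟨hU ▸ MeasurableSet.biUnion hC fun c _ => hIic c, le_antisymm ?_ ?_⟩
  · rw [hU, measure_biUnion_eq_iSup hC]
    · exact iSup₂_le fun c _ => le_iSup₂ (f := fun x (_ : x ∈ X) => P (Set.Iic x)) c.1 c.2
    · have hmono : Monotone fun x : X => Set.Iic (x : R) := fun _ _ hab => Set.Iic_subset_Iic.2 hab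
      intro a ha b hb
      rcases le_total a b with hab | hab
      · exact ⟨b, hb, hmono hab, subset_rfl⟩
      · exact ⟨a, ha, subset_rfl, hmono hab⟩
  · exact iSup₂_le fun x hx =>
      measure_mono (Set.subset_biUnion_of_mem (u := fun x : R => Set.Iic x) hx)
end

section
/- Let R be a linear order that admits an order embedding of ω₁ into R. Then there exist a σ-algebra Σ on R containing every initial segment (-∞, r] and a probability measure P on Σ such that, setting f̂(r) = P(-∞, r] for r ∈ R, one has P{r : f̂(r) ≤ 0} = 1 and 0 belongs to the range of f̂. -/
open MeasureTheory

lemma countable_Iic_omega1 (a : Omega1) : (Set.Iic a).Countable := by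
  have h : (Set.Iio a.1).Countable := by
    rw [← Cardinal.le_aleph0_iff_set_countable, Cardinal.mk_Iio_ordinal]
    exact Cardinal.lift_le_aleph0.2 a.2
  have h' : (Set.Iic a.1).Countable := by
    rw [← Set.Iio_insert]
    exact h.insert _
  exact (h'.preimage Subtype.val_injective).mono fun _ hb => hb

lemma not_countable_univ_omega1 : ¬ (Set.univ : Set Omega1).Countable := by
  intro h
  have h2 : {o : Ordinal.{0} | o.card ≤ Cardinal.aleph0} = Set.Iio (Cardinal.aleph 1).ord := by
    ext o
    simp only [Set.mem_ofPred_eq, Set.mem_Iio, Cardinal.lt_ord]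
    rw [← Cardinal.succ_aleph0, Order.lt_succ_iff]
  have h3 : {o : Ordinal.{0} | o.card ≤ Cardinal.aleph0}.Countable :=
    Set.countable_coe_iff.1 (Set.countable_univ_iff.1 h)
  rw [h2, ← Cardinal.le_aleph0_iff_set_countable, Cardinal.mk_Iio_ordinal,
    Cardinal.card_ord, Cardinal.lift_le_aleph0] at h3
  exact absurd h3 (not_le.2 Cardinal.aleph0_lt_aleph_one)

open Classical in
/-- The outer measure that vanishes on the sets with countable preimage under `f` and is `1` on
all other sets. -/
noncomputable def countablePreimageOuterMeasure {α β : Type*} (f : α → β) : OuterMeasure β where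
  measureOf s := if (f ⁻¹' s).Countable then 0 else 1
  empty := by simp
  mono {s t} hst := by
    by_cases h : (f ⁻¹' t).Countable
    · simp [h.mono (Set.preimage_mono hst), h]
    · rw [if_neg h]
      split_ifs <;> simp
  iUnion_nat s _ := by
    by_cases h : ∀ i, (f ⁻¹' s i).Countable
    · simp [Set.preimage_iUnion, h]
    · push Not at h
      obtain ⟨i, hi⟩ := h
      refine le_trans ?_ (ENNReal.le_tsum i)
      rw [if_neg hi]
      split_ifs <;> simp

section

variable {α β : Type*} {f : α → β} {s : Set β}

lemma countablePreimageOuterMeasure_of_countable (h : (f ⁻¹' s).Countable) :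
    countablePreimageOuterMeasure f s = 0 :=
  if_pos h

lemma countablePreimageOuterMeasure_of_not_countable (h : ¬ (f ⁻¹' s).Countable) :
    countablePreimageOuterMeasure f s = 1 :=
  if_neg h

lemma isCaratheodory_of_countable_preimage (h : (f ⁻¹' s).Countable) :
    (countablePreimageOuterMeasure f).IsCaratheodory s := by
  rw [OuterMeasure.isCaratheodory_iff_le']
  intro t
  rw [countablePreimageOuterMeasure_of_countable (h.mono (Set.preimage_mono Set.inter_subset_right)),
    zero_add]
  exact (countablePreimageOuterMeasure f).mono Set.sdiff_subset

end

theorem stmt9 (R : Type*) [LinearOrder R] (hlong : Nonempty (Omega1 ↪o R)) :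
    ∃ Sig : MeasurableSpace R,
      (∀ r : R, MeasurableSet[Sig] (Set.Iic r)) ∧
      ∃ P : @Measure R Sig,
        @IsProbabilityMeasure R Sig P ∧
        P {r : R | P (Set.Iic r) = 0} = 1 ∧
        (∃ r : R, P (Set.Iic r) = 0) := by
  obtain ⟨f⟩ := hlong
  let m := countablePreimageOuterMeasure f
  let Sig : MeasurableSpace R := m.caratheodory
  have meas_of_univ {s : Set R} (hs : f ⁻¹' s = Set.univ) : MeasurableSet s := by
    rw [← MeasurableSet.compl_iff]
    exact isCaratheodory_of_countable_preimage (by simp [hs])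
  have hIic (r : R) : MeasurableSet (Set.Iic r) := by
    by_cases h : ∀ a, f a ≤ r
    · exact meas_of_univ (Set.eq_univ_of_forall h)
    · push Not at h
      obtain ⟨a, ha⟩ := h
      refine isCaratheodory_of_countable_preimage ((countable_Iic_omega1 a).mono fun b hb => ?_)
      exact (f.lt_iff_lt.1 (lt_of_le_of_lt hb ha)).le
  let P : Measure R := m.toMeasure le_rfl
  have P_one {s : Set R} (hs : f ⁻¹' s = Set.univ) : P s = 1 := by
    rw [toMeasure_apply _ _ (meas_of_univ hs)]
    exact countablePreimageOuterMeasure_of_not_countable (by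
      rw [hs]
      exact not_countable_univ_omega1)
  have P_zero (a : Omega1) : P (Set.Iic (f a)) = 0 := by
    rw [toMeasure_apply _ _ (hIic _)]
    refine countablePreimageOuterMeasure_of_countable ((countable_Iic_omega1 a).mono fun b hb => ?_)
    exact f.le_iff_le.1 hb
  exact ⟨Sig, hIic, P, ⟨P_one Set.preimage_univ⟩, P_one (Set.eq_univ_of_forall P_zero),
    f ⟨0, by simp⟩, P_zero _⟩
end
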